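/- Let S be a finite set of paths and D a finite set of decision nodes. For each s ∈ S let p(s) ∈ [0,1] be its path probability and U(s) > 0 its path utility, and for each s ∈ S, j ∈ D let ζ(s,j) ∈ {0,1} be fixed values of the binary strategy variables relevant to path s. Call π : S → ℝ feasible if 0 ≤ π(s) ≤ p(s) and π(s) ≤ ζ(s,j) for all s ∈ S and j ∈ D. If π* is feasible and maximizes Σ_{s∈S} π(s)·U(s) over all feasible π, then π*(s) = p(s) · ∏_{j∈D} ζ(s,j) for every s ∈ S. In particular, when all path utilities are positive, the lower-bound constraint π(s) ≥ p(s) + Σ_{j∈D} ζ(s,j) − |D| can be dropped without changing the optimum: it is automatically satisfied at every maximizer. -/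

import Mathlib

/-- A binary family is either constantly one or has a vanishing entry. -/
theorem forall_eq_one_or_exists_eq_zero {D : Type*} {z : D → ℝ}
    (hz : ∀ j, z j = 0 ∨ z j = 1) : (∀ j, z j = 1) ∨ ∃ j, z j = 0 := by
  by_contra! h
  obtain ⟨⟨j, hj⟩, h0⟩ := h
  exact (hz j).elim (h0 j) hj

/-- For binary `z`, the value `p * ∏ j, z j` satisfies `0 ≤ x ≤ p` and `x ≤ z j`. -/
theorem mul_prod_binary_feasible {D : Type*} [Fintype D] {p : ℝ} (hp : 0 ≤ p ∧ p ≤ 1)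
    {z : D → ℝ} (hz : ∀ j, z j = 0 ∨ z j = 1) :
    0 ≤ p * ∏ j, z j ∧ p * ∏ j, z j ≤ p ∧ ∀ j, p * ∏ j, z j ≤ z j := by
  rcases forall_eq_one_or_exists_eq_zero hz with h | ⟨i, hi⟩
  · simp [h, hp]
  · rw [Finset.prod_eq_zero (Finset.mem_univ i) hi, mul_zero]
    exact ⟨le_rfl, hp.1, fun j => (hz j).elim (fun h => h.ge) (fun h => h ▸ zero_le_one)⟩

/-- For binary `z`, any `x` with `x ≤ p` and `x ≤ z j` is at most `p * ∏ j, z j`. -/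
theorem le_mul_prod_binary {D : Type*} [Fintype D] {p x : ℝ} {z : D → ℝ}
    (hz : ∀ j, z j = 0 ∨ z j = 1) (hxp : x ≤ p) (hxz : ∀ j, x ≤ z j) :
    x ≤ p * ∏ j, z j := by
  rcases forall_eq_one_or_exists_eq_zero hz with h | ⟨i, hi⟩
  · simpa [h] using hxp
  · rw [Finset.prod_eq_zero (Finset.mem_univ i) hi, mul_zero]
    exact hi ▸ hxz i

/-- For binary `z` and `p ∈ [0,1]`, the value `p * ∏ j, z j` is at least `p + ∑ j, z j - |D|`. -/
theorem add_sum_sub_card_le_mul_prod_binary {D : Type*} [Fintype D] {p : ℝ}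
    (hp : p ≤ 1) {z : D → ℝ} (hz : ∀ j, z j = 0 ∨ z j = 1) :
    p + (∑ j, z j) - (Fintype.card D : ℝ) ≤ p * ∏ j, z j := by
  rcases forall_eq_one_or_exists_eq_zero hz with h | ⟨i, hi⟩
  · simp [h]
  · have hsum : ∑ j, (1 - z j) = (Fintype.card D : ℝ) - ∑ j, z j := by
      simp [Finset.sum_sub_distrib]
    have hle : 1 - z i ≤ ∑ j, (1 - z j) :=
      Finset.single_le_sum (f := fun j => 1 - z j)
        (fun j _ => by rcases hz j with h | h <;> simp [h]) (Finset.mem_univ i)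
    rw [Finset.prod_eq_zero (Finset.mem_univ i) hi, mul_zero]
    linarith

/-- With fixed binary strategy-variable values `ζ s j ∈ {0,1}`, path probabilities
`p s ∈ [0,1]` and positive path utilities `U s > 0`, any `π⋆` that is feasible for the
constraints `0 ≤ π s ≤ p s` and `π s ≤ ζ s j` and maximizes the expected utility
`∑ s, π s · U s` over all feasible `π` satisfies `π⋆ s = p s · ∏ j, ζ s j` for every
path `s`; in particular the lower-bound constraint
`π s ≥ p s + ∑ j, ζ s j − |D|` is automatically satisfied at every maximizer. -/
theorem dropped_lower_bound_holds_at_maximizer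
    {S D : Type} [Fintype S] [Fintype D]
    (p : S → ℝ) (hp : ∀ s, 0 ≤ p s ∧ p s ≤ 1)
    (U : S → ℝ) (hU : ∀ s, 0 < U s)
    (ζ : S → D → ℝ) (hζ : ∀ s j, ζ s j = 0 ∨ ζ s j = 1)
    (πstar : S → ℝ)
    (hfeas : ∀ s, 0 ≤ πstar s ∧ πstar s ≤ p s ∧ ∀ j, πstar s ≤ ζ s j)
    (hopt : ∀ π : S → ℝ, (∀ s, 0 ≤ π s ∧ π s ≤ p s ∧ ∀ j, π s ≤ ζ s j) →
      ∑ s, π s * U s ≤ ∑ s, πstar s * U s) :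
    ∀ s, πstar s = p s * ∏ j, ζ s j ∧
      p s + (∑ j, ζ s j) - (Fintype.card D : ℝ) ≤ πstar s := by
  have hle : ∀ s ∈ Finset.univ, πstar s * U s ≤ (p s * ∏ j, ζ s j) * U s := fun s _ =>
    mul_le_mul_of_nonneg_right
      (le_mul_prod_binary (hζ s) (hfeas s).2.1 (hfeas s).2.2) (hU s).le
  have hsum := le_antisymm (Finset.sum_le_sum hle)
    (hopt (fun s => p s * ∏ j, ζ s j) fun s => mul_prod_binary_feasible (hp s) (hζ s))
  intro s
  have heq : πstar s = p s * ∏ j, ζ s j :=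
    mul_right_cancel₀ (hU s).ne'
      ((Finset.sum_eq_sum_iff_of_le hle).1 hsum s (Finset.mem_univ s))
  exact ⟨heq, heq ▸ add_sum_sub_card_le_mul_prod_binary (hp s).2 (hζ s)⟩
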